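/- Assume 2·G·η_max² > e·c and 0 < p ≤ p_th, where p_th = e·c·G·η_max² / ((2·G·η_max² − e·c)·ε₀) and e is the base of the natural logarithm. Then the equilibrium inspection intensity m*(η) = ln(p·ε*(η)/c)/ε*(η) is monotonically increasing in η on (0, η_max]. -/

import Mathlib

/-- The map `x ↦ (1 + 1 / log x) / x` is strictly decreasing on `(1, ∞)`. -/
theorem strictAntiOn_one_add_inv_log_div :
    StrictAntiOn (fun x : ℝ => (1 + (Real.log x)⁻¹) / x) (Set.Ioi 1) := by
  intro x hx y _ hxy
  have hx1 : (1 : ℝ) < x := hx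
  have hx0 : 0 < x := by linarith
  have hLx : 0 < Real.log x := Real.log_pos hx1
  have hL : Real.log x < Real.log y := Real.log_lt_log hx0 hxy
  have hinv : (Real.log y)⁻¹ < (Real.log x)⁻¹ := inv_strictAnti₀ hLx hL
  have hLx' : 0 < (Real.log x)⁻¹ := inv_pos.mpr hLx
  exact div_lt_div₀ (by linarith) hxy.le (by linarith) hx0

/-- The map `x ↦ log x / x` is increasing on `(0, e]`. -/
theorem monotoneOn_log_div_self :
    MonotoneOn (fun x : ℝ => Real.log x / x) (Set.Ioc 0 (Real.exp 1)) := by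
  intro x hx y hy hxy
  obtain ⟨hx0, hxe⟩ := hx
  obtain ⟨hy0, hye⟩ := hy
  have hL : Real.log x ≤ Real.log y := Real.log_le_log hx0 hxy
  have hLy : Real.log y ≤ 1 := (Real.log_le_iff_le_exp hy0).mpr hye
  rcases le_or_gt (Real.log y) 0 with hneg | hpos
  · show Real.log x / x ≤ Real.log y / y
    rw [div_le_div_iff₀ hx0 hy0]
    nlinarith
  · have hxy' : y * (1 - (Real.log y - Real.log x)) ≤ x := by
      have h := Real.add_one_le_exp (Real.log x - Real.log y)
      rw [Real.exp_sub, Real.exp_log hx0, Real.exp_log hy0, le_div_iff₀ hy0] at h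
      linarith
    show Real.log x / x ≤ Real.log y / y
    rw [div_le_div_iff₀ hx0 hy0]
    have h1 := mul_le_mul_of_nonneg_left hxy' hpos.le
    have h2 : 0 ≤ y * ((Real.log y - Real.log x) * (1 - Real.log y)) :=
      mul_nonneg hy0.le (mul_nonneg (by linarith) (by linarith))
    linarith


/-- Low-fine regime: if `2·G·η_max² > e·c` and `0 < p ≤ p_th`, then the
equilibrium inspection intensity `m*(η) = ln(p·ε*(η)/c)/ε*(η)` is monotonically
increasing in `η` on `(0, η_max]`. -/
theorem inspection_intensity_low_fine_regime
    (G p ε₀ c ηmax : ℝ) (hG : 0 < G) (hp : 0 < p) (hε₀ : 0 < ε₀) (hc : 0 < c)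
    (hηmax : ηmax ∈ Set.Ioc (0 : ℝ) 1)
    (hreg : 2 * G * ηmax ^ 2 > Real.exp 1 * c)
    (hpth : p ≤ Real.exp 1 * c * G * ηmax ^ 2 /
        ((2 * G * ηmax ^ 2 - Real.exp 1 * c) * ε₀))
    (εstar : ℝ → ℝ)
    (hεstar : ∀ η : ℝ, 0 < η → εstar η ∈ Set.Ioi (c / p) ∧
      ((p + G * η ^ 2 / ε₀) * εstar η - G * η ^ 2) *
          Real.log (p * εstar η / c) = G * η ^ 2) :
    MonotoneOn (fun η : ℝ => Real.log (p * εstar η / c) / εstar η)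
      (Set.Ioc 0 ηmax) := by
  have hx1 : ∀ η : ℝ, 0 < η → 1 < p * εstar η / c := by
    intro η hη
    have h : c / p < εstar η := (hεstar η hη).1
    rw [div_lt_iff₀ hp] at h
    rw [lt_div_iff₀ hc]
    linarith
  have hkey : ∀ η : ℝ, 0 < η →
      (1 + (Real.log (p * εstar η / c))⁻¹) / (p * εstar η / c) =
        c * (1 / (G * η ^ 2) + 1 / (p * ε₀)) := by
    intro η hη
    have hL := Real.log_pos (hx1 η hη)
    have hε : 0 < εstar η := lt_trans (div_pos hc hp) (hεstar η hη).1
    have h := (hεstar η hη).2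
    generalize Real.log (p * εstar η / c) = L at h hL ⊢
    generalize εstar η = ε at h hε ⊢
    field_simp at h ⊢
    linarith
  have hanti := strictAntiOn_one_add_inv_log_div
  have hmono : ∀ η₁ η₂ : ℝ, 0 < η₁ → η₁ ≤ η₂ →
      p * εstar η₁ / c ≤ p * εstar η₂ / c := by
    intro η₁ η₂ h₁ h₁₂
    have h₂ : 0 < η₂ := lt_of_lt_of_le h₁ h₁₂
    refine (hanti.le_iff_ge (hx1 η₂ h₂) (hx1 η₁ h₁)).mp ?_
    simp only [hkey η₁ h₁, hkey η₂ h₂]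
    gcongr
  have hmax : p * εstar ηmax / c ≤ Real.exp 1 := by
    have he : (1 : ℝ) < Real.exp 1 := Real.one_lt_exp_iff.mpr one_pos
    refine (hanti.le_iff_ge he (hx1 ηmax hηmax.1)).mp ?_
    simp only [hkey ηmax hηmax.1, Real.log_exp]
    have hA : 0 < G * ηmax ^ 2 := mul_pos hG (pow_pos hηmax.1 2)
    have he0 := Real.exp_pos 1
    have hD : 0 < 2 * G * ηmax ^ 2 - Real.exp 1 * c := by linarith
    rw [le_div_iff₀ (mul_pos hD hε₀)] at hpth
    rw [div_add_div _ _ hA.ne' (mul_pos hp hε₀).ne', mul_div_assoc', div_le_div_iff₀ he0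
      (mul_pos hA (mul_pos hp hε₀))]
    linarith
  intro η₁ h₁ η₂ h₂ h₁₂
  have hle : ∀ η ∈ Set.Ioc 0 ηmax, p * εstar η / c ∈ Set.Ioc 0 (Real.exp 1) := fun η hη =>
    ⟨one_pos.trans (hx1 η hη.1), (hmono η ηmax hη.1 hη.2).trans hmax⟩
  have hm := monotoneOn_log_div_self (hle η₁ h₁) (hle η₂ h₂) (hmono η₁ η₂ h₁.1 h₁₂)
  have hscale : ∀ L ε : ℝ, L / ε = p / c * (L / (p * ε / c)) := by
    intro L ε
    rcases eq_or_ne ε 0 with rfl | hε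
    · simp
    · field_simp
  simp only at hm ⊢
  rw [hscale _ (εstar η₁), hscale _ (εstar η₂)]
  exact mul_le_mul_of_nonneg_left hm (div_pos hp hc).le
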